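/- Consider the boundary value problem u₁''(t) + λ₁ f₁(t,u₁(t),u₁'(t),u₂(t),u₂'(t),u₂''(t),u₂'''(t)) = 0 and u₂''''(t) = λ₂ f₂(t,u₁(t),u₁'(t),u₂(t),u₂'(t),u₂''(t),u₂'''(t)) on (0,1), with u₁(0) = 0, u₁(1) = η₁₁h₁₁[(u₁,u₂)], u₂(0) = η₂₁h₂₁[(u₁,u₂)], u₂''(0) = u₂(1) = u₂''(1) = 0, where f₁(t,x₁₀,x₁₁,x₂₀,x₂₁,x₂₂,x₂₃) := x₁₀²·(2 − t·sin(x₁₁ + x₂₂)), f₂(t,x₁₀,x₁₁,x₂₀,x₂₁,x₂₂,x₂₃) := √(x₂₀)·e^{t(x₁₀ + x₂₃)}, h₁₁[(u₁,u₂)] := ∫₀¹ (u₁'(t)+u₂'''(t))² dt, h₂₁[(u₁,u₂)] := (u₁'(1/4))² + (u₂''(3/4))⁴. If λ₂ > 0 and max{ (3/2)λ₁ + 4η₁₁, (5e²/24)λ₂ + 2η₂₁, (e²/2)λ₂ } ≤ 1 (for instance λ₁ = 1/10, λ₂ = 1/5, η₁₁ = 1/5, η₂₁ = 1/3), then the boundary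 value problem has a solution (u₁,u₂) ∈ P with 0 < ‖(u₁,u₂)‖ ≤ 1. -/

import Mathlib

open Set MeasureTheory Real

/-- `j`-th derivative on `[0,1]`. -/
noncomputable def D (j : ℕ) (g : ℝ → ℝ) : ℝ → ℝ :=
  iteratedDerivWithin j g (Set.Icc 0 1)

/-- Sup norm on `[0,1]`. -/
noncomputable def sup01 (g : ℝ → ℝ) : ℝ := ⨆ t : Set.Icc (0:ℝ) 1, |g ↑t|

/-- The norm of `C¹[0,1] × C³[0,1]`. -/
noncomputable def normPair (u₁ u₂ : ℝ → ℝ) : ℝ :=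
  max (max (sup01 u₁) (sup01 (D 1 u₁)))
    (max (max (sup01 u₂) (sup01 (D 1 u₂))) (max (sup01 (D 2 u₂)) (sup01 (D 3 u₂))))

/-- The nonlinearity `f₁(t,x₁₀,x₁₁,x₂₀,x₂₁,x₂₂,x₂₃) = x₁₀²(2 − t sin(x₁₁+x₂₂))`. -/
noncomputable def f₁ex (t x₁₀ x₁₁ x₂₀ x₂₁ x₂₂ x₂₃ : ℝ) : ℝ :=
  x₁₀ ^ 2 * (2 - t * Real.sin (x₁₁ + x₂₂))

/-- The nonlinearity `f₂(t,x₁₀,x₁₁,x₂₀,x₂₁,x₂₂,x₂₃) = √x₂₀ · e^{t(x₁₀+x₂₃)}`. -/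
noncomputable def f₂ex (t x₁₀ x₁₁ x₂₀ x₂₁ x₂₂ x₂₃ : ℝ) : ℝ :=
  Real.sqrt x₂₀ * Real.exp (t * (x₁₀ + x₂₃))

/-- The functional `h₁₁[(u₁,u₂)] = ∫₀¹ (u₁'(t)+u₂'''(t))² dt`. -/
noncomputable def h₁₁ex (u₁ u₂ : ℝ → ℝ) : ℝ :=
  ∫ t in (0:ℝ)..1, (D 1 u₁ t + D 3 u₂ t) ^ 2

/-- The functional `h₂₁[(u₁,u₂)] = (u₁'(1/4))² + (u₂''(3/4))⁴`. -/
noncomputable def h₂₁ex (u₁ u₂ : ℝ → ℝ) : ℝ :=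
  (D 1 u₁ (1 / 4)) ^ 2 + (D 2 u₂ (3 / 4)) ^ 4

/-- The primitive of `q` vanishing at `0`. -/
noncomputable def prim (q : ℝ → ℝ) (t : ℝ) : ℝ := ∫ s in (0:ℝ)..t, q s

/-- The derivative of `green q`. -/
noncomputable def greenDeriv (q : ℝ → ℝ) (t : ℝ) : ℝ :=
  (∫ s in (0:ℝ)..1, prim q s) - prim q t

/-- The solution of `-v'' = q`, `v 0 = v 1 = 0`. -/
noncomputable def green (q : ℝ → ℝ) : ℝ → ℝ := prim (greenDeriv q)

lemma hasDerivAt_prim {q : ℝ → ℝ} (hq : Continuous q) (t : ℝ) :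
    HasDerivAt (prim q) (q t) t :=
  intervalIntegral.integral_hasDerivAt_right (hq.intervalIntegrable _ _)
    (hq.stronglyMeasurableAtFilter _ _) hq.continuousAt

@[fun_prop]
lemma continuous_prim {q : ℝ → ℝ} (hq : Continuous q) : Continuous (prim q) :=
  continuous_iff_continuousAt.2 fun t => (hasDerivAt_prim hq t).continuousAt

lemma prim_zero (q : ℝ → ℝ) : prim q 0 = 0 := by simp [prim]

lemma hasDerivAt_greenDeriv {q : ℝ → ℝ} (hq : Continuous q) (t : ℝ) :
    HasDerivAt (greenDeriv q) (-q t) t :=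
  (hasDerivAt_prim hq t).const_sub _

@[fun_prop]
lemma continuous_greenDeriv {q : ℝ → ℝ} (hq : Continuous q) : Continuous (greenDeriv q) :=
  continuous_iff_continuousAt.2 fun t => (hasDerivAt_greenDeriv hq t).continuousAt

lemma hasDerivAt_green {q : ℝ → ℝ} (hq : Continuous q) (t : ℝ) :
    HasDerivAt (green q) (greenDeriv q t) t :=
  hasDerivAt_prim (continuous_greenDeriv hq) t

@[fun_prop]
lemma continuous_green {q : ℝ → ℝ} (hq : Continuous q) : Continuous (green q) :=
  continuous_prim (continuous_greenDeriv hq)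

lemma green_zero (q : ℝ → ℝ) : green q 0 = 0 := prim_zero _

lemma green_one {q : ℝ → ℝ} (hq : Continuous q) : green q 1 = 0 := by
  change ∫ s in (0:ℝ)..1, ((∫ r in (0:ℝ)..1, prim q r) - prim q s) = 0
  rw [intervalIntegral.integral_sub (by simp)
    ((continuous_prim hq).intervalIntegrable _ _)]
  simp

lemma prim_sub {q r : ℝ → ℝ} (hq : Continuous q) (hr : Continuous r) :
    prim (fun s => q s - r s) = fun t => prim q t - prim r t := by
  funext t
  exact intervalIntegral.integral_sub (hq.intervalIntegrable _ _) (hr.intervalIntegrable _ _)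

lemma prim_const_mul (c : ℝ) (q : ℝ → ℝ) :
    prim (fun s => c * q s) = fun t => c * prim q t := by
  funext t
  exact intervalIntegral.integral_const_mul c q

lemma greenDeriv_sub {q r : ℝ → ℝ} (hq : Continuous q) (hr : Continuous r) :
    greenDeriv (fun s => q s - r s) = fun t => greenDeriv q t - greenDeriv r t := by
  funext t
  simp only [greenDeriv, prim_sub hq hr]
  rw [intervalIntegral.integral_sub ((continuous_prim hq).intervalIntegrable _ _)
    ((continuous_prim hr).intervalIntegrable _ _)]
  ring

lemma greenDeriv_const_mul (c : ℝ) (q : ℝ → ℝ) :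
    greenDeriv (fun s => c * q s) = fun t => c * greenDeriv q t := by
  funext t
  simp only [greenDeriv, prim_const_mul, intervalIntegral.integral_const_mul]
  ring

lemma green_sub {q r : ℝ → ℝ} (hq : Continuous q) (hr : Continuous r) :
    green (fun s => q s - r s) = fun t => green q t - green r t := by
  simp only [green]
  rw [greenDeriv_sub hq hr,
    prim_sub (continuous_greenDeriv hq) (continuous_greenDeriv hr)]

lemma green_const_mul (c : ℝ) (q : ℝ → ℝ) :
    green (fun s => c * q s) = fun t => c * green q t := by
  simp only [green]
  rw [greenDeriv_const_mul, prim_const_mul]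

lemma green_eq_of_hasDerivAt {y y' q : ℝ → ℝ} (hq : Continuous q)
    (hy : ∀ t, HasDerivAt y (y' t) t) (hy' : ∀ t, HasDerivAt y' (-q t) t)
    (h0 : y 0 = 0) (h1 : y 1 = 0) : green q = y := by
  have hc : Continuous y' := continuous_iff_continuousAt.2 fun t => (hy' t).continuousAt
  have hp : prim q = fun t => y' 0 - y' t := by
    funext t
    have h := intervalIntegral.integral_eq_sub_of_hasDerivAt (a := 0) (b := t)
      (fun s _ => hy' s) (hq.neg.intervalIntegrable _ _)
    rw [intervalIntegral.integral_neg] at h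
    simp only [prim]
    linarith
  have hint : ∀ t, ∫ s in (0:ℝ)..t, y' s = y t - y 0 := fun t =>
    intervalIntegral.integral_eq_sub_of_hasDerivAt (fun s _ => hy s)
      (hc.intervalIntegrable _ _)
  have hd : greenDeriv q = y' := by
    funext t
    simp only [greenDeriv, hp]
    rw [intervalIntegral.integral_sub (by simp) (hc.intervalIntegrable _ _), hint]
    simp [h0, h1]
  funext t
  simp only [green, hd, prim, hint, h0, sub_zero]

lemma abs_prim_le {q : ℝ → ℝ} {M : ℝ} (h : ∀ t ∈ Icc (0:ℝ) 1, |q t| ≤ M) {t : ℝ}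
    (ht : t ∈ Icc (0:ℝ) 1) : |prim q t| ≤ M := by
  have hM : 0 ≤ M := (abs_nonneg _).trans (h t ht)
  have := intervalIntegral.norm_integral_le_of_norm_le_const (a := 0) (b := t) (f := q)
    (C := M) (fun s hs => by
      rw [uIoc_of_le ht.1] at hs
      exact h s ⟨hs.1.le, hs.2.trans ht.2⟩)
  rw [Real.norm_eq_abs, sub_zero, abs_of_nonneg ht.1] at this
  exact this.trans (mul_le_of_le_one_right hM ht.2)

lemma abs_integral_le {q : ℝ → ℝ} {M : ℝ} (h : ∀ t ∈ Icc (0:ℝ) 1, |q t| ≤ M) :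
    |∫ s in (0:ℝ)..1, q s| ≤ M :=
  abs_prim_le h (right_mem_Icc.2 zero_le_one)

lemma abs_greenDeriv_le {q : ℝ → ℝ} {M : ℝ} (h : ∀ t ∈ Icc (0:ℝ) 1, |q t| ≤ M) {t : ℝ}
    (ht : t ∈ Icc (0:ℝ) 1) : |greenDeriv q t| ≤ 2 * M := by
  have h1 := abs_integral_le (q := prim q) fun s hs => abs_prim_le h hs
  have h2 := abs_prim_le h ht
  have := abs_sub (∫ s in (0:ℝ)..1, prim q s) (prim q t)
  unfold greenDeriv
  linarith

lemma abs_green_le {q : ℝ → ℝ} {M : ℝ} (h : ∀ t ∈ Icc (0:ℝ) 1, |q t| ≤ M) {t : ℝ}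
    (ht : t ∈ Icc (0:ℝ) 1) : |green q t| ≤ 2 * M :=
  abs_prim_le (fun _ hs => abs_greenDeriv_le h hs) ht

lemma green_nonneg {q : ℝ → ℝ} (hq : Continuous q) (h : ∀ t ∈ Icc (0:ℝ) 1, 0 ≤ q t) {t : ℝ}
    (ht : t ∈ Icc (0:ℝ) 1) : 0 ≤ green q t := by
  have hconc : ConcaveOn ℝ (Icc (0:ℝ) 1) (green q) := by
    apply AntitoneOn.concaveOn_of_deriv (convex_Icc 0 1) (continuous_green hq).continuousOn
    · exact fun s _ => (hasDerivAt_green hq s).differentiableAt.differentiableWithinAt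
    · rw [funext fun s => (hasDerivAt_green hq s).deriv]
      apply antitoneOn_of_deriv_nonpos (convex_Icc 0 1 |>.interior)
        (continuous_greenDeriv hq).continuousOn
      · exact fun s _ => (hasDerivAt_greenDeriv hq s).differentiableAt.differentiableWithinAt
      · intro s hs
        rw [(hasDerivAt_greenDeriv hq s).deriv]
        simpa using h s (interior_subset (interior_subset hs))
  have := hconc.2 (left_mem_Icc.2 zero_le_one) (right_mem_Icc.2 zero_le_one)
    (sub_nonneg.2 ht.2) ht.1 (by ring)
  simpa [green_zero, green_one hq] using this

lemma green_mono {q r : ℝ → ℝ} (hq : Continuous q) (hr : Continuous r)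
    (h : ∀ t ∈ Icc (0:ℝ) 1, q t ≤ r t) {t : ℝ} (ht : t ∈ Icc (0:ℝ) 1) :
    green q t ≤ green r t := by
  have := green_nonneg (hr.sub hq) (fun s hs => sub_nonneg.2 (h s hs)) ht
  rw [show green (r - q) = _ from green_sub hr hq] at this
  linarith

lemma green_parabola :
    green (fun t => t * (1 - t)) = fun t => (t - 2 * t ^ 3 + t ^ 4) / 12 := by
  apply green_eq_of_hasDerivAt (y' := fun t => (1 - 6 * t ^ 2 + 4 * t ^ 3) / 12) (by fun_prop)
  · intro t
    have h := (((hasDerivAt_id t).sub ((hasDerivAt_pow 3 t).const_mul 2)).add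
      (hasDerivAt_pow 4 t)).div_const 12
    exact h.congr_deriv (by push_cast; ring)
  · intro t
    have h := (((hasDerivAt_const t (1:ℝ)).sub ((hasDerivAt_pow 2 t).const_mul 6)).add
      ((hasDerivAt_pow 3 t).const_mul 4)).div_const 12
    exact h.congr_deriv (by push_cast; ring)
  · norm_num
  · norm_num

lemma green_one_fun : green (fun _ => (1:ℝ)) = fun t => 1 / 2 * (t * (1 - t)) := by
  apply green_eq_of_hasDerivAt (y' := fun t => 1 / 2 * (1 - 2 * t)) (by fun_prop)
  · intro t
    have h := (((hasDerivAt_id t).mul ((hasDerivAt_id t).const_sub 1))).const_mul (1 / 2 : ℝ)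
    exact h.congr_deriv (by simp; ring)
  · intro t
    have h := (((hasDerivAt_id t).const_mul 2).const_sub 1).const_mul (1 / 2 : ℝ)
    exact h.congr_deriv (by simp)
  · norm_num
  · norm_num

lemma green_green_parabola :
    green (green fun t => t * (1 - t)) =
      fun t => (t / 10 - t ^ 3 / 6 + t ^ 5 / 10 - t ^ 6 / 30) / 12 := by
  rw [green_parabola]
  apply green_eq_of_hasDerivAt
    (y' := fun t => (1 / 10 - t ^ 2 / 2 + t ^ 4 / 2 - t ^ 5 / 5) / 12) (by fun_prop)
  · intro t
    have h := (((((hasDerivAt_id t).div_const 10).sub ((hasDerivAt_pow 3 t).div_const 6)).add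
      ((hasDerivAt_pow 5 t).div_const 10)).sub ((hasDerivAt_pow 6 t).div_const 30)).div_const 12
    exact h.congr_deriv (by push_cast; ring)
  · intro t
    have h := ((((hasDerivAt_const t (1 / 10 : ℝ)).sub ((hasDerivAt_pow 2 t).div_const 2)).add
      ((hasDerivAt_pow 4 t).div_const 2)).sub ((hasDerivAt_pow 5 t).div_const 5)).div_const 12
    exact h.congr_deriv (by push_cast; ring)
  · norm_num
  · norm_num

lemma parabola_le_quarter (t : ℝ) : t * (1 - t) ≤ 1 / 4 := by nlinarith [sq_nonneg (t - 1 / 2)]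

lemma parabola_nonneg {t : ℝ} (ht : t ∈ Icc (0:ℝ) 1) : 0 ≤ t * (1 - t) :=
  mul_nonneg ht.1 (sub_nonneg.2 ht.2)

lemma le_green_green {q : ℝ → ℝ} {c : ℝ} (hq : Continuous q) (hc : 0 ≤ c)
    (h : ∀ t ∈ Icc (0:ℝ) 1, c * (t * (1 - t)) ≤ q t) {t : ℝ} (ht : t ∈ Icc (0:ℝ) 1) :
    c / 120 * (t * (1 - t)) ≤ green (green q) t := by
  have hcont : Continuous fun t : ℝ => c * (t * (1 - t)) := by fun_prop
  have h1 := green_mono (continuous_green hcont) (continuous_green hq)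
    (fun s hs => green_mono hcont hq h hs) ht
  rw [green_const_mul, green_const_mul, green_green_parabola] at h1
  have h2 : 0 ≤ c * (t ^ 2 * (1 - t) ^ 2 * (3 + t * (1 - t))) := by
    have := parabola_nonneg ht
    positivity
  nlinarith

lemma green_green_le {q : ℝ → ℝ} {M : ℝ} (hq : Continuous q) (hM : 0 ≤ M)
    (h : ∀ t ∈ Icc (0:ℝ) 1, q t ≤ M) {t : ℝ} (ht : t ∈ Icc (0:ℝ) 1) :
    green (green q) t ≤ 5 / 96 * M * (t * (1 - t)) := by
  have hcont : Continuous fun _ : ℝ => M * 1 := by fun_prop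
  have h1 := green_mono (continuous_green hq) (continuous_green hcont)
    (fun s hs => green_mono hq hcont (fun s hs => by simpa using h s hs) hs) ht
  rw [green_const_mul, green_const_mul, green_one_fun, green_const_mul, green_parabola] at h1
  have h2 : 0 ≤ M * (t * (1 - t) * (1 / 4 - t * (1 - t))) := by
    have := parabola_nonneg ht
    have := sub_nonneg.2 (parabola_le_quarter t)
    positivity
  nlinarith

lemma abs_green_green_sub_le {q r : ℝ → ℝ} {d : ℝ} (hq : Continuous q) (hr : Continuous r)
    (h : ∀ t ∈ Icc (0:ℝ) 1, |q t - r t| ≤ d) {t : ℝ} (ht : t ∈ Icc (0:ℝ) 1) :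
    |green (green q) t - green (green r) t| ≤ 5 / 96 * d * (t * (1 - t)) := by
  have hd : 0 ≤ d := (abs_nonneg _).trans (h t ht)
  have h1 := green_green_le (hq.sub hr) hd (fun s hs => (abs_le.1 (h s hs)).2) ht
  have h2 := green_green_le (hr.sub hq) hd
    (fun s hs => by have := (abs_le.1 (h s hs)).1; simp only [Pi.sub_apply]; linarith) ht
  rw [show green (q - r) = _ from green_sub hq hr,
    green_sub (continuous_green hq) (continuous_green hr)] at h1
  rw [show green (r - q) = _ from green_sub hr hq,
    green_sub (continuous_green hr) (continuous_green hq)] at h2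
  exact abs_le.2 ⟨by linarith, h1⟩

/-- The right-hand side of the fixed point equation for the rescaled fourth derivative of `u₂`. -/
noncomputable def profileMap (ε β : ℝ) (z p : ℝ → ℝ) (t : ℝ) : ℝ :=
  √(β * (1 - t) + green (green p) t) * exp (t * (ε * (prim z t - greenDeriv p t)))

/-- The rescaled nonlinearity of the first equation. -/
noncomputable def source (ε : ℝ) (z p : ℝ → ℝ) (t : ℝ) : ℝ :=
  prim z t ^ 2 * (2 - t * sin (ε * (z t - green p t)))

/-- The right-hand side of the fixed point equation for the rescaled derivative of `u₁`. -/
noncomputable def slopeMap (ε lam η : ℝ) (z p : ℝ → ℝ) (t : ℝ) : ℝ :=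
  ε * (η * (∫ s in (0:ℝ)..1, (z s - greenDeriv p s) ^ 2) + lam * greenDeriv (source ε z p) t)

/-- The region in which the fixed point is sought. -/
structure Admissible (z p : ℝ → ℝ) : Prop where
  cont_left : Continuous z
  cont_right : Continuous p
  abs_left_le : ∀ t ∈ Icc (0:ℝ) 1, |z t| ≤ 1 / 10000
  le_right : ∀ t ∈ Icc (0:ℝ) 1, 3 / 100 * (t * (1 - t)) ≤ p t
  right_le : ∀ t ∈ Icc (0:ℝ) 1, p t ≤ 1 / 50

lemma continuous_profileMap {z p : ℝ → ℝ} (hz : Continuous z) (hp : Continuous p) (ε β : ℝ) :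
    Continuous (profileMap ε β z p) := by
  unfold profileMap
  fun_prop

lemma continuous_source {z p : ℝ → ℝ} (hz : Continuous z) (hp : Continuous p) (ε : ℝ) :
    Continuous (source ε z p) := by
  unfold source
  fun_prop

lemma continuous_slopeMap {z p : ℝ → ℝ} (hz : Continuous z) (hp : Continuous p) (ε lam η : ℝ) :
    Continuous (slopeMap ε lam η z p) := by
  have := continuous_source hz hp ε
  unfold slopeMap
  fun_prop

namespace Admissible

variable {z p z' p' : ℝ → ℝ} {ε β t d : ℝ}

lemma abs_right_le (h : Admissible z p) : ∀ t ∈ Icc (0:ℝ) 1, |p t| ≤ 1 / 50 := by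
  intro t ht
  have h1 := parabola_nonneg ht
  exact abs_le.2 ⟨by linarith [h.le_right t ht], h.right_le t ht⟩

lemma radicand_ge (h : Admissible z p) (hβ : β ∈ Icc (0:ℝ) (1 / 10 ^ 8))
    (ht : t ∈ Icc (0:ℝ) 1) :
    1 / 4000 * (t * (1 - t)) ≤ β * (1 - t) + green (green p) t := by
  have h1 := le_green_green h.cont_right (by norm_num) h.le_right ht
  have h2 := mul_nonneg hβ.1 (sub_nonneg.2 ht.2)
  linarith

lemma radicand_le (h : Admissible z p) (hβ : β ∈ Icc (0:ℝ) (1 / 10 ^ 8))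
    (ht : t ∈ Icc (0:ℝ) 1) :
    β * (1 - t) + green (green p) t ≤ (1 / 60) ^ 2 := by
  have h1 := green_green_le h.cont_right (by norm_num) h.right_le ht
  have h2 : β * (1 - t) ≤ 1 / 10 ^ 8 * 1 :=
    mul_le_mul hβ.2 (by linarith [ht.1]) (sub_nonneg.2 ht.2) (by norm_num)
  have h3 := parabola_le_quarter t
  norm_num at *
  linarith

lemma sqrt_radicand_ge (h : Admissible z p) (hβ : β ∈ Icc (0:ℝ) (1 / 10 ^ 8))
    (ht : t ∈ Icc (0:ℝ) 1) :
    √(t * (1 - t)) / 64 ≤ √(β * (1 - t) + green (green p) t) := by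
  apply Real.le_sqrt_of_sq_le
  rw [div_pow, Real.sq_sqrt (parabola_nonneg ht)]
  have := h.radicand_ge hβ ht
  have := parabola_nonneg ht
  linarith

lemma sqrt_radicand_le (h : Admissible z p) (hβ : β ∈ Icc (0:ℝ) (1 / 10 ^ 8))
    (ht : t ∈ Icc (0:ℝ) 1) :
    √(β * (1 - t) + green (green p) t) ≤ 1 / 60 :=
  Real.sqrt_le_iff.2 ⟨by norm_num, h.radicand_le hβ ht⟩

lemma abs_exponent_le (h : Admissible z p) (hε : ε ∈ Icc (0:ℝ) (1 / 10))
    (ht : t ∈ Icc (0:ℝ) 1) :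
    |t * (ε * (prim z t - greenDeriv p t))| ≤ 1 / 200 := by
  have h0 := hε.1
  have h1 := abs_prim_le h.abs_left_le ht
  have h2 := abs_greenDeriv_le h.abs_right_le ht
  have h3 := abs_sub (prim z t) (greenDeriv p t)
  rw [abs_mul, abs_mul, abs_of_nonneg ht.1, abs_of_nonneg hε.1]
  calc t * (ε * |prim z t - greenDeriv p t|) ≤ 1 * (1 / 10 * (1 / 20)) := by
        gcongr
        · exact ht.2
        · exact hε.2
        · linarith
    _ ≤ 1 / 200 := by norm_num

lemma exp_exponent_le (h : Admissible z p) (hε : ε ∈ Icc (0:ℝ) (1 / 10))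
    (ht : t ∈ Icc (0:ℝ) 1) :
    exp (t * (ε * (prim z t - greenDeriv p t))) ≤ 200 / 199 := by
  have h1 := (abs_le.1 (h.abs_exponent_le hε ht)).2
  set a := t * (ε * (prim z t - greenDeriv p t))
  have h2 := Real.add_one_le_exp (-a)
  have h3 : exp a * exp (-a) = 1 := by rw [← Real.exp_add]; simp
  have h4 := Real.exp_pos a
  nlinarith

lemma le_exp_exponent (h : Admissible z p) (hε : ε ∈ Icc (0:ℝ) (1 / 10))
    (ht : t ∈ Icc (0:ℝ) 1) :
    199 / 200 ≤ exp (t * (ε * (prim z t - greenDeriv p t))) := by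
  have h1 := (abs_le.1 (h.abs_exponent_le hε ht)).1
  have h2 := Real.add_one_le_exp (t * (ε * (prim z t - greenDeriv p t)))
  linarith

lemma le_profileMap (h : Admissible z p) (hε : ε ∈ Icc (0:ℝ) (1 / 10))
    (hβ : β ∈ Icc (0:ℝ) (1 / 10 ^ 8)) (ht : t ∈ Icc (0:ℝ) 1) :
    3 / 100 * (t * (1 - t)) ≤ profileMap ε β z p t := by
  have h1 := h.sqrt_radicand_ge hβ ht
  have h2 := h.le_exp_exponent hε ht
  have h3 := parabola_nonneg ht
  have h4 := Real.sq_sqrt h3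
  have h5 : √(t * (1 - t)) ≤ 1 / 2 :=
    Real.sqrt_le_iff.2 ⟨by norm_num, by linarith [parabola_le_quarter t]⟩
  have h6 := Real.sqrt_nonneg (t * (1 - t))
  calc 3 / 100 * (t * (1 - t)) ≤ √(t * (1 - t)) / 64 * (199 / 200) := by nlinarith
    _ ≤ _ := mul_le_mul h1 h2 (by norm_num) (Real.sqrt_nonneg _)

lemma profileMap_le (h : Admissible z p) (hε : ε ∈ Icc (0:ℝ) (1 / 10))
    (hβ : β ∈ Icc (0:ℝ) (1 / 10 ^ 8)) (ht : t ∈ Icc (0:ℝ) 1) :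
    profileMap ε β z p t ≤ 1 / 50 :=
  calc profileMap ε β z p t ≤ 1 / 60 * (200 / 199) :=
        mul_le_mul (h.sqrt_radicand_le hβ ht) (h.exp_exponent_le hε ht) (Real.exp_pos _).le
          (by norm_num)
    _ ≤ 1 / 50 := by norm_num

lemma abs_sqrt_radicand_sub_le (h : Admissible z p) (h' : Admissible z' p')
    (hβ : β ∈ Icc (0:ℝ) (1 / 10 ^ 8))
    (hd : ∀ t ∈ Icc (0:ℝ) 1, |p t - p' t| ≤ d) (ht : t ∈ Icc (0:ℝ) 1) :
    |√(β * (1 - t) + green (green p) t) - √(β * (1 - t) + green (green p') t)|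
      ≤ 5 / 6 * d := by
  have hd0 : 0 ≤ d := (abs_nonneg _).trans (hd t ht)
  have hφ := parabola_nonneg ht
  have h1 := h.sqrt_radicand_ge hβ ht
  have h1' := h'.sqrt_radicand_ge hβ ht
  have h2 := abs_green_green_sub_le h.cont_right h'.cont_right hd ht
  have h3 := Real.sq_sqrt ((mul_nonneg (by norm_num) hφ).trans (h.radicand_ge hβ ht))
  have h3' := Real.sq_sqrt ((mul_nonneg (by norm_num) hφ).trans (h'.radicand_ge hβ ht))
  have ha := Real.sqrt_nonneg (β * (1 - t) + green (green p) t)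
  have hb := Real.sqrt_nonneg (β * (1 - t) + green (green p') t)
  set a := √(β * (1 - t) + green (green p) t)
  set b := √(β * (1 - t) + green (green p') t)
  have hs2 := Real.sq_sqrt hφ
  have hs : √(t * (1 - t)) ≤ 1 / 2 :=
    Real.sqrt_le_iff.2 ⟨by norm_num, by linarith [parabola_le_quarter t]⟩
  have hs0 := Real.sqrt_nonneg (t * (1 - t))
  set s := √(t * (1 - t))
  have h4 : |a - b| * (a + b) ≤ 5 / 96 * d * s ^ 2 := by
    rw [← abs_of_nonneg (add_nonneg ha hb), ← abs_mul, hs2]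
    rwa [show (a - b) * (a + b) = β * (1 - t) + green (green p) t -
      (β * (1 - t) + green (green p') t) by linear_combination h3 - h3', add_sub_add_left_eq_sub]
  rcases hs0.eq_or_lt with hs0 | hs0
  · have hab : (a - b) * (a + b) = 0 := by
      rw [← abs_eq_zero, abs_mul, abs_of_nonneg (add_nonneg ha hb)]
      rw [← hs0] at h4
      exact le_antisymm (by simpa using h4) (by positivity)
    have : a - b = 0 := by
      rcases mul_eq_zero.1 hab with h | h <;> linarith
    rw [this, abs_zero]
    positivity
  · have h5 : |a - b| * (s / 32) ≤ 5 / 96 * d * s ^ 2 :=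
      (mul_le_mul_of_nonneg_left (by linarith) (abs_nonneg _)).trans h4
    have h6 : |a - b| * s ≤ 5 / 3 * d * s * s := by linarith
    have h7 := le_of_mul_le_mul_right h6 hs0
    nlinarith

lemma abs_exp_exponent_sub_le (h : Admissible z p) (h' : Admissible z' p')
    (hε : ε ∈ Icc (0:ℝ) (1 / 10)) (hd : ∀ t ∈ Icc (0:ℝ) 1, |z t - z' t| ≤ d)
    (hd' : ∀ t ∈ Icc (0:ℝ) 1, |p t - p' t| ≤ d) (ht : t ∈ Icc (0:ℝ) 1) :
    |exp (t * (ε * (prim z t - greenDeriv p t))) -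
      exp (t * (ε * (prim z' t - greenDeriv p' t)))| ≤ 9 / 10 * d := by
  have h1 := abs_prim_le hd ht
  have h2 := abs_greenDeriv_le hd' ht
  rw [prim_sub h.cont_left h'.cont_left] at h1
  rw [greenDeriv_sub h.cont_right h'.cont_right] at h2
  have he := h'.exp_exponent_le hε ht
  have ha := abs_le.1 (h.abs_exponent_le hε ht)
  have hb := abs_le.1 (h'.abs_exponent_le hε ht)
  have hab : |t * (ε * (prim z t - greenDeriv p t)) - t * (ε * (prim z' t - greenDeriv p' t))|
      ≤ 3 / 10 * d := by
    have h0 := hε.1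
    have h3 := abs_sub (prim z t - prim z' t) (greenDeriv p t - greenDeriv p' t)
    rw [show t * (ε * (prim z t - greenDeriv p t)) - t * (ε * (prim z' t - greenDeriv p' t)) =
      t * (ε * (prim z t - prim z' t - (greenDeriv p t - greenDeriv p' t))) by ring,
      abs_mul, abs_mul, abs_of_nonneg ht.1, abs_of_nonneg hε.1]
    calc t * (ε * |prim z t - prim z' t - (greenDeriv p t - greenDeriv p' t)|)
        ≤ 1 * (1 / 10 * (3 * d)) := by
          gcongr
          · exact ht.2
          · exact hε.2
          · linarith
      _ = 3 / 10 * d := by ring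
  set a := t * (ε * (prim z t - greenDeriv p t))
  set b := t * (ε * (prim z' t - greenDeriv p' t))
  have h4 : |exp (a - b) - 1| ≤ 2 * |a - b| :=
    Real.abs_exp_sub_one_le (abs_le.2 ⟨by linarith, by linarith⟩)
  have h5 : exp a - exp b = exp b * (exp (a - b) - 1) := by
    rw [mul_sub, ← Real.exp_add]; simp
  rw [h5, abs_mul, Real.abs_exp]
  calc exp b * |exp (a - b) - 1| ≤ 3 / 2 * (2 * (3 / 10 * d)) := by
        gcongr
        · linarith
        · linarith
    _ = 9 / 10 * d := by ring

lemma abs_profileMap_sub_le (h : Admissible z p) (h' : Admissible z' p')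
    (hε : ε ∈ Icc (0:ℝ) (1 / 10)) (hβ : β ∈ Icc (0:ℝ) (1 / 10 ^ 8))
    (hd : ∀ t ∈ Icc (0:ℝ) 1, |z t - z' t| ≤ d)
    (hd' : ∀ t ∈ Icc (0:ℝ) 1, |p t - p' t| ≤ d) (ht : t ∈ Icc (0:ℝ) 1) :
    |profileMap ε β z p t - profileMap ε β z' p' t| ≤ 9 / 10 * d := by
  have h1 := h.abs_sqrt_radicand_sub_le h' hβ hd' ht
  have h2 := h.abs_exp_exponent_sub_le h' hε hd hd' ht
  have h3 := h.exp_exponent_le hε ht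
  have h4 := h'.sqrt_radicand_le hβ ht
  have h5 : 0 ≤ d := (abs_nonneg _).trans (hd t ht)
  unfold profileMap
  set a := √(β * (1 - t) + green (green p) t)
  set b := √(β * (1 - t) + green (green p') t)
  set e := exp (t * (ε * (prim z t - greenDeriv p t)))
  set e' := exp (t * (ε * (prim z' t - greenDeriv p' t)))
  have h6 : |a * e - b * e'| ≤ |a - b| * |e| + |b| * |e - e'| := by
    rw [← abs_mul, ← abs_mul, show a * e - b * e' = (a - b) * e + b * (e - e') by ring]
    exact abs_add_le _ _
  rw [abs_of_nonneg (Real.sqrt_nonneg _ : 0 ≤ b), abs_of_pos (Real.exp_pos _ : 0 < e)] at h6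
  calc |a * e - b * e'| ≤ 5 / 6 * d * (200 / 199) + 1 / 60 * (9 / 10 * d) := by
        refine h6.trans ?_
        gcongr
    _ ≤ 9 / 10 * d := by linarith

lemma abs_profileMap_sub_le_sqrt {β' : ℝ} (h : Admissible z p)
    (hε : ε ∈ Icc (0:ℝ) (1 / 10)) (hβ : β ∈ Icc (0:ℝ) (1 / 10 ^ 8))
    (hβ' : β' ∈ Icc (0:ℝ) (1 / 10 ^ 8)) (ht : t ∈ Icc (0:ℝ) 1) :
    |profileMap ε β z p t - profileMap ε β' z p t| ≤ 2 * √|β - β'| := by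
  have key : ∀ {x y : ℝ}, 0 ≤ x → √y ≤ √x + √|x - y| := fun {x y} hx => by
    have h0 := Real.sqrt_nonneg x
    have h1 := Real.sqrt_nonneg |x - y|
    refine Real.sqrt_le_iff.2 ⟨by positivity, ?_⟩
    nlinarith [Real.sq_sqrt hx, Real.sq_sqrt (abs_nonneg (x - y)), neg_abs_le (x - y),
      le_abs_self (x - y)]
  have hφ := parabola_nonneg ht
  have hx := (mul_nonneg (by norm_num) hφ).trans (h.radicand_ge hβ ht)
  have hy := (mul_nonneg (by norm_num) hφ).trans (h.radicand_ge hβ' ht)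
  have h1 := key (y := β' * (1 - t) + green (green p) t) hx
  have h2 := key (y := β * (1 - t) + green (green p) t) hy
  have h3 : ∀ x y : ℝ, √|x * (1 - t) + green (green p) t - (y * (1 - t) + green (green p) t)|
      ≤ √|x - y| := fun x y => by
    apply Real.sqrt_le_sqrt
    rw [show x * (1 - t) + green (green p) t - (y * (1 - t) + green (green p) t) =
      (x - y) * (1 - t) by ring, abs_mul, abs_of_nonneg (sub_nonneg.2 ht.2)]
    exact mul_le_of_le_one_right (abs_nonneg _) (by linarith [ht.1])
  have h4 := h3 β β'
  have h5 := h3 β' β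
  rw [abs_sub_comm β' β] at h5
  have h6 := h.exp_exponent_le hε ht
  unfold profileMap
  rw [← sub_mul, abs_mul, Real.abs_exp, mul_comm]
  have h7 : |√(β * (1 - t) + green (green p) t) - √(β' * (1 - t) + green (green p) t)|
      ≤ √|β - β'| := abs_le.2 ⟨by linarith, by linarith⟩
  exact mul_le_mul (by linarith) h7 (abs_nonneg _) (by norm_num)

lemma sq_prim_le (h : Admissible z p) (ht : t ∈ Icc (0:ℝ) 1) :
    prim z t ^ 2 ≤ (1 / 10000) ^ 2 := by
  rw [← sq_abs]
  have := abs_prim_le h.abs_left_le ht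
  gcongr

lemma source_nonneg (ht : t ∈ Icc (0:ℝ) 1) : 0 ≤ source ε z p t := by
  refine mul_nonneg (sq_nonneg _) ?_
  nlinarith [Real.sin_le_one (ε * (z t - green p t)), ht.1, ht.2]

lemma abs_factor_le (x : ℝ) (ht : t ∈ Icc (0:ℝ) 1) : |2 - t * sin x| ≤ 3 := by
  have h1 := Real.sin_le_one x
  have h2 := Real.neg_one_le_sin x
  exact abs_le.2 ⟨by nlinarith [ht.1, ht.2], by nlinarith [ht.1, ht.2]⟩

lemma abs_source_le (h : Admissible z p) (ht : t ∈ Icc (0:ℝ) 1) :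
    |source ε z p t| ≤ (1 / 10000) ^ 2 * 3 := by
  unfold source
  rw [abs_mul, abs_of_nonneg (sq_nonneg _)]
  exact mul_le_mul (h.sq_prim_le ht) (abs_factor_le _ ht) (abs_nonneg _) (by norm_num)

lemma abs_source_sub_le (h : Admissible z p) (h' : Admissible z' p')
    (hε : ε ∈ Icc (0:ℝ) (1 / 10)) (hd : ∀ t ∈ Icc (0:ℝ) 1, |z t - z' t| ≤ d)
    (hd' : ∀ t ∈ Icc (0:ℝ) 1, |p t - p' t| ≤ d) (ht : t ∈ Icc (0:ℝ) 1) :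
    |source ε z p t - source ε z' p' t| ≤ d := by
  have h0 : 0 ≤ d := (abs_nonneg _).trans (hd t ht)
  have h1 := abs_prim_le hd ht
  have h2 := abs_green_le hd' ht
  rw [prim_sub h.cont_left h'.cont_left] at h1
  rw [green_sub h.cont_right h'.cont_right] at h2
  have hz := abs_prim_le h.abs_left_le ht
  have hz' := abs_prim_le h'.abs_left_le ht
  have hx : |t * sin (ε * (z t - green p t)) - t * sin (ε * (z' t - green p' t))|
      ≤ 3 / 10 * d := by
    have h3 : |sin (ε * (z t - green p t)) - sin (ε * (z' t - green p' t))| ≤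
        |ε * (z t - green p t) - ε * (z' t - green p' t)| := by
      simpa [Real.dist_eq] using
        Real.lipschitzWith_sin.dist_le_mul (ε * (z t - green p t)) (ε * (z' t - green p' t))
    have h4 := abs_sub (z t - z' t) (green p t - green p' t)
    have h5 := hd t ht
    rw [← mul_sub, abs_mul, abs_of_nonneg ht.1]
    calc t * |sin (ε * (z t - green p t)) - sin (ε * (z' t - green p' t))|
        ≤ 1 * |ε * (z t - green p t) - ε * (z' t - green p' t)| := by
          gcongr
          exact ht.2
      _ = ε * |z t - z' t - (green p t - green p' t)| := by
          rw [one_mul, ← abs_of_nonneg hε.1, ← abs_mul, abs_of_nonneg hε.1]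
          congr 1; ring
      _ ≤ 1 / 10 * (3 * d) := by
          gcongr
          · exact hε.2
          · linarith
      _ = 3 / 10 * d := by ring
  have hsq : |prim z t ^ 2 - prim z' t ^ 2| ≤ 1 / 5000 * d := by
    rw [sq_sub_sq, abs_mul]
    have := abs_add_le (prim z t) (prim z' t)
    gcongr
    linarith
  have hf := abs_factor_le (ε * (z t - green p t)) ht
  have hsq' := h'.sq_prim_le ht
  unfold source
  set A := prim z t ^ 2
  set A' := prim z' t ^ 2
  set s := t * sin (ε * (z t - green p t))
  set s' := t * sin (ε * (z' t - green p' t))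
  have h6 : |A * (2 - s) - A' * (2 - s')| ≤ |A - A'| * |2 - s| + |A'| * |s - s'| := by
    rw [← abs_mul, ← abs_mul, show A * (2 - s) - A' * (2 - s') =
      (A - A') * (2 - s) - A' * (s - s') by ring]
    exact abs_sub _ _
  rw [abs_of_nonneg (sq_nonneg _ : 0 ≤ A')] at h6
  calc _ ≤ 1 / 5000 * d * 3 + (1 / 10000) ^ 2 * (3 / 10 * d) := by
        refine h6.trans ?_
        gcongr
    _ ≤ d := by norm_num; linarith

lemma abs_sub_greenDeriv_le (h : Admissible z p) (ht : t ∈ Icc (0:ℝ) 1) :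
    |z t - greenDeriv p t| ≤ 1 / 20 := by
  have h1 := h.abs_left_le t ht
  have h2 := abs_greenDeriv_le h.abs_right_le ht
  have := abs_sub (z t) (greenDeriv p t)
  linarith

lemma abs_slopeMap_le {lam η : ℝ} (h : Admissible z p) (hε : ε ∈ Icc (0:ℝ) (1 / 10))
    (hlam : lam ∈ Icc (0:ℝ) (2 / 3)) (hη : η ∈ Icc (0:ℝ) (1 / 4)) (ht : t ∈ Icc (0:ℝ) 1) :
    |slopeMap ε lam η z p t| ≤ 1 / 10000 := by
  have h1 : |∫ s in (0:ℝ)..1, (z s - greenDeriv p s) ^ 2| ≤ (401 / 10000) ^ 2 := by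
    refine abs_integral_le fun s hs => ?_
    have h1 := h.abs_left_le s hs
    have h2 := abs_greenDeriv_le h.abs_right_le hs
    have := abs_sub (z s) (greenDeriv p s)
    rw [abs_pow]
    gcongr
    linarith
  have h2 := abs_greenDeriv_le (fun s hs => h.abs_source_le (ε := ε) hs) ht
  unfold slopeMap
  rw [abs_mul, abs_of_nonneg hε.1]
  have h3 := abs_add_le (η * ∫ s in (0:ℝ)..1, (z s - greenDeriv p s) ^ 2)
    (lam * greenDeriv (source ε z p) t)
  rw [abs_mul, abs_mul, abs_of_nonneg hη.1, abs_of_nonneg hlam.1] at h3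
  calc _ ≤ (1 / 10 : ℝ) * (1 / 4 * (401 / 10000) ^ 2 + 2 / 3 * (2 * ((1 / 10000) ^ 2 * 3))) := by
        refine mul_le_mul hε.2 (h3.trans ?_) (abs_nonneg _) (by norm_num)
        have := hη.2
        have := hlam.2
        gcongr
    _ ≤ 1 / 10000 := by norm_num

lemma abs_slopeMap_sub_le {lam η : ℝ} (h : Admissible z p) (h' : Admissible z' p')
    (hε : ε ∈ Icc (0:ℝ) (1 / 10)) (hlam : lam ∈ Icc (0:ℝ) (2 / 3))
    (hη : η ∈ Icc (0:ℝ) (1 / 4)) (hd : ∀ t ∈ Icc (0:ℝ) 1, |z t - z' t| ≤ d)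
    (hd' : ∀ t ∈ Icc (0:ℝ) 1, |p t - p' t| ≤ d) (ht : t ∈ Icc (0:ℝ) 1) :
    |slopeMap ε lam η z p t - slopeMap ε lam η z' p' t| ≤ 9 / 10 * d := by
  have h0 : 0 ≤ d := (abs_nonneg _).trans (hd t ht)
  have hint : ∀ {z p : ℝ → ℝ}, Admissible z p →
      IntervalIntegrable (fun s => (z s - greenDeriv p s) ^ 2) volume 0 1 := fun h => by
    have := h.cont_left
    have := h.cont_right
    exact Continuous.intervalIntegrable (by fun_prop) _ _
  have h1 : |(∫ s in (0:ℝ)..1, (z s - greenDeriv p s) ^ 2) -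
      ∫ s in (0:ℝ)..1, (z' s - greenDeriv p' s) ^ 2| ≤ 1 / 10 * (3 * d) := by
    rw [← intervalIntegral.integral_sub (hint h) (hint h')]
    refine abs_integral_le fun s hs => ?_
    have h1 := abs_greenDeriv_le hd' hs
    rw [greenDeriv_sub h.cont_right h'.cont_right] at h1
    have h2 := hd s hs
    have h3 := abs_sub (z s - z' s) (greenDeriv p s - greenDeriv p' s)
    have h4 := abs_add_le (z s - greenDeriv p s) (z' s - greenDeriv p' s)
    have h5 := h.abs_sub_greenDeriv_le hs
    have h5' := h'.abs_sub_greenDeriv_le hs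
    rw [sq_sub_sq, abs_mul]
    gcongr
    · linarith
    · rw [show z s - greenDeriv p s - (z' s - greenDeriv p' s) =
        z s - z' s - (greenDeriv p s - greenDeriv p' s) by ring]
      linarith
  have h2 := abs_greenDeriv_le
    (fun s hs => h.abs_source_sub_le h' hε hd hd' hs) ht
  rw [greenDeriv_sub (continuous_source h.cont_left h.cont_right ε)
    (continuous_source h'.cont_left h'.cont_right ε)] at h2
  unfold slopeMap
  set a := ∫ s in (0:ℝ)..1, (z s - greenDeriv p s) ^ 2
  set a' := ∫ s in (0:ℝ)..1, (z' s - greenDeriv p' s) ^ 2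
  set g := greenDeriv (source ε z p) t
  set g' := greenDeriv (source ε z' p') t
  rw [show ε * (η * a + lam * g) - ε * (η * a' + lam * g') =
    ε * (η * (a - a') + lam * (g - g')) by ring, abs_mul, abs_of_nonneg hε.1]
  have h3 := abs_add_le (η * (a - a')) (lam * (g - g'))
  rw [abs_mul, abs_mul, abs_of_nonneg hη.1, abs_of_nonneg hlam.1] at h3
  calc _ ≤ 1 / 10 * (1 / 4 * (1 / 10 * (3 * d)) + 2 / 3 * (2 * d)) := by
        refine mul_le_mul hε.2 (h3.trans ?_) (abs_nonneg _) (by norm_num)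
        have := hη.2
        have := hlam.2
        gcongr
    _ ≤ 9 / 10 * d := by linarith

lemma profile_slope {lam η : ℝ} (h : Admissible z p) (hε : ε ∈ Icc (0:ℝ) (1 / 10))
    (hβ : β ∈ Icc (0:ℝ) (1 / 10 ^ 8)) (hlam : lam ∈ Icc (0:ℝ) (2 / 3))
    (hη : η ∈ Icc (0:ℝ) (1 / 4)) :
    Admissible (slopeMap ε lam η z p) (profileMap ε β z p) where
  cont_left := continuous_slopeMap h.cont_left h.cont_right ε lam η
  cont_right := continuous_profileMap h.cont_left h.cont_right ε β
  abs_left_le _ ht := h.abs_slopeMap_le hε hlam hη ht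
  le_right _ ht := h.le_profileMap hε hβ ht
  right_le _ ht := h.profileMap_le hε hβ ht

end Admissible

/-- The constant extension to `ℝ` of a continuous function on `[0,1]`. -/
noncomputable def extendIcc (q : C(Icc (0:ℝ) 1, ℝ)) : ℝ → ℝ := IccExtend zero_le_one q

lemma continuous_extendIcc (q : C(Icc (0:ℝ) 1, ℝ)) : Continuous (extendIcc q) :=
  q.continuous.Icc_extend'

lemma extendIcc_apply (q : C(Icc (0:ℝ) 1, ℝ)) {t : ℝ} (ht : t ∈ Icc (0:ℝ) 1) :
    extendIcc q t = q ⟨t, ht⟩ :=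
  IccExtend_of_mem _ _ ht

/-- The restriction to `[0,1]` of a continuous function on `ℝ`. -/
def restrictIcc (q : ℝ → ℝ) (hq : Continuous q) : C(Icc (0:ℝ) 1, ℝ) :=
  ⟨fun t => q t, hq.comp continuous_subtype_val⟩

lemma extendIcc_restrictIcc {q : ℝ → ℝ} (hq : Continuous q) {t : ℝ} (ht : t ∈ Icc (0:ℝ) 1) :
    extendIcc (restrictIcc q hq) t = q t :=
  extendIcc_apply _ ht

lemma abs_extendIcc_sub_le (q r : C(Icc (0:ℝ) 1, ℝ)) :
    ∀ t ∈ Icc (0:ℝ) 1, |extendIcc q t - extendIcc r t| ≤ dist q r := fun t ht => by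
  rw [extendIcc_apply q ht, extendIcc_apply r ht, ← Real.dist_eq]
  exact ContinuousMap.dist_apply_le_dist _

/-- The pairs of continuous functions on `[0,1]` whose extensions are admissible. -/
def admissibleSet : Set (C(Icc (0:ℝ) 1, ℝ) × C(Icc (0:ℝ) 1, ℝ)) :=
  {x | ∀ t : Icc (0:ℝ) 1, |x.1 t| ≤ 1 / 10000 ∧ 3 / 100 * ((t : ℝ) * (1 - t)) ≤ x.2 t ∧
    x.2 t ≤ 1 / 50}

lemma isClosed_admissibleSet : IsClosed admissibleSet := by
  simp only [admissibleSet, ofPred_forall, ofPred_and]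
  refine isClosed_iInter fun t => ?_
  have h1 : Continuous fun x : C(Icc (0:ℝ) 1, ℝ) × C(Icc (0:ℝ) 1, ℝ) => x.1 t := by fun_prop
  have h2 : Continuous fun x : C(Icc (0:ℝ) 1, ℝ) × C(Icc (0:ℝ) 1, ℝ) => x.2 t := by fun_prop
  exact (isClosed_le h1.abs continuous_const).inter
    ((isClosed_le continuous_const h2).inter (isClosed_le h2 continuous_const))

instance : CompleteSpace admissibleSet :=
  isClosed_admissibleSet.completeSpace_coe

instance : Nonempty admissibleSet :=
  ⟨⟨(0, ContinuousMap.const _ (1 / 50)), fun t => by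
    have := parabola_le_quarter (t : ℝ)
    refine ⟨by simp, ?_, le_rfl⟩
    simp only [ContinuousMap.const_apply]
    linarith⟩⟩

lemma admissible_extendIcc (x : admissibleSet) : Admissible (extendIcc x.1.1) (extendIcc x.1.2) where
  cont_left := continuous_extendIcc _
  cont_right := continuous_extendIcc _
  abs_left_le t ht := by rw [extendIcc_apply _ ht]; exact (x.2 ⟨t, ht⟩).1
  le_right t ht := by rw [extendIcc_apply _ ht]; exact (x.2 ⟨t, ht⟩).2.1
  right_le t ht := by rw [extendIcc_apply _ ht]; exact (x.2 ⟨t, ht⟩).2.2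

section FixedPoint

variable {ε lam η : ℝ} (hε : ε ∈ Icc (0:ℝ) (1 / 10)) (hlam : lam ∈ Icc (0:ℝ) (2 / 3))
  (hη : η ∈ Icc (0:ℝ) (1 / 4))

/-- The pair `(slopeMap, profileMap)` as a self-map of the admissible set. -/
noncomputable def stepMap (β : Icc (0:ℝ) (1 / 10 ^ 8)) (x : admissibleSet) : admissibleSet :=
  have h := (admissible_extendIcc x).profile_slope hε β.2 hlam hη
  ⟨(restrictIcc _ h.cont_left, restrictIcc _ h.cont_right), fun t =>
    ⟨h.abs_left_le t t.2, h.le_right t t.2, h.right_le t t.2⟩⟩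

lemma contracting_stepMap (β : Icc (0:ℝ) (1 / 10 ^ 8)) :
    ContractingWith (9 / 10) (stepMap hε hlam hη β) := by
  refine ⟨by rw [← NNReal.coe_lt_coe]; norm_num, LipschitzWith.of_dist_le_mul fun x y => ?_⟩
  have hd : ∀ t ∈ Icc (0:ℝ) 1, |extendIcc x.1.1 t - extendIcc y.1.1 t| ≤ dist x y := fun t ht =>
    (abs_extendIcc_sub_le _ _ t ht).trans (le_max_left _ _)
  have hd' : ∀ t ∈ Icc (0:ℝ) 1, |extendIcc x.1.2 t - extendIcc y.1.2 t| ≤ dist x y := fun t ht =>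
    (abs_extendIcc_sub_le _ _ t ht).trans (le_max_right _ _)
  have hx := admissible_extendIcc x
  have hy := admissible_extendIcc y
  have h0 : (0:ℝ) ≤ 9 / 10 * dist x y := by positivity
  push_cast
  refine max_le ?_ ?_
  · exact (ContinuousMap.dist_le h0).2 fun t => hx.abs_slopeMap_sub_le hy hε hlam hη hd hd' t.2
  · exact (ContinuousMap.dist_le h0).2 fun t => hx.abs_profileMap_sub_le hy hε β.2 hd hd' t.2

lemma dist_stepMap_le (β β' : Icc (0:ℝ) (1 / 10 ^ 8)) (x : admissibleSet) :
    dist (stepMap hε hlam hη β x) (stepMap hε hlam hη β' x) ≤ 2 * √|(β : ℝ) - β'| := by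
  refine max_le ?_ ?_
  · rw [show (stepMap hε hlam hη β x).1.1 = (stepMap hε hlam hη β' x).1.1 from rfl, dist_self]
    positivity
  · exact (ContinuousMap.dist_le (by positivity)).2 fun t =>
      (admissible_extendIcc x).abs_profileMap_sub_le_sqrt hε β.2 β'.2 t.2

/-- The fixed point of `stepMap`. -/
noncomputable def stepFixedPoint (β : Icc (0:ℝ) (1 / 10 ^ 8)) : admissibleSet :=
  ContractingWith.fixedPoint _ (contracting_stepMap hε hlam hη β)

lemma continuous_stepFixedPoint : Continuous (stepFixedPoint hε hlam hη) := by
  rw [continuous_iff_continuousAt]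
  intro β
  rw [ContinuousAt, tendsto_iff_dist_tendsto_zero]
  have hlim : Filter.Tendsto (fun β' : Icc (0:ℝ) (1 / 10 ^ 8) =>
      2 * √|(β' : ℝ) - β| / (1 - ((9 / 10 : NNReal) : ℝ))) (nhds β) (nhds 0) := by
    have : Continuous fun β' : Icc (0:ℝ) (1 / 10 ^ 8) =>
        2 * √|(β' : ℝ) - β| / (1 - ((9 / 10 : NNReal) : ℝ)) := by fun_prop
    simpa using this.tendsto β
  refine squeeze_zero (fun _ => dist_nonneg) (fun β' => ?_) hlim
  exact (contracting_stepMap hε hlam hη β').fixedPoint_lipschitz_in_map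
    (contracting_stepMap hε hlam hη β) (dist_stepMap_le hε hlam hη β' β)

lemma continuous_green_extendIcc (t : ℝ) (ht : t ∈ Icc (0:ℝ) 1) :
    Continuous fun q : C(Icc (0:ℝ) 1, ℝ) => green (extendIcc q) t := by
  refine (LipschitzWith.of_dist_le_mul (K := 2) fun q r => ?_).continuous
  have := abs_green_le (abs_extendIcc_sub_le q r) ht
  rw [green_sub (continuous_extendIcc q) (continuous_extendIcc r)] at this
  simpa [Real.dist_eq] using this

include hε hlam hη in
/-- Existence for the rescaled system, with the boundary parameter `β` determined by the
nonlocal condition. -/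
lemma exists_rescaled_solution {θ : ℝ} (hθ : θ ∈ Icc (0:ℝ) (1 / 2)) :
    ∃ z p : ℝ → ℝ, ∃ β ∈ Icc (0:ℝ) (1 / 10 ^ 8), Admissible z p ∧
      (∀ t ∈ Icc (0:ℝ) 1, z t = slopeMap ε lam η z p t) ∧
      (∀ t ∈ Icc (0:ℝ) 1, p t = profileMap ε β z p t) ∧
      β = θ * (ε * z (1 / 4) ^ 2 + ε ^ 3 * green p (3 / 4) ^ 4) := by
  have h14 : (1 / 4 : ℝ) ∈ Icc (0:ℝ) 1 := by norm_num
  have h34 : (3 / 4 : ℝ) ∈ Icc (0:ℝ) 1 := by norm_num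
  let F : Icc (0:ℝ) (1 / 10 ^ 8) → ℝ := fun β =>
    θ * (ε * extendIcc (stepFixedPoint hε hlam hη β).1.1 (1 / 4) ^ 2 +
      ε ^ 3 * green (extendIcc (stepFixedPoint hε hlam hη β).1.2) (3 / 4) ^ 4)
  have hF : Continuous F := by
    have h0 := continuous_stepFixedPoint hε hlam hη
    have h1 : Continuous fun β => extendIcc (stepFixedPoint hε hlam hη β).1.1 (1 / 4) := by
      simp only [extendIcc_apply _ h14]
      fun_prop
    have h2 : Continuous fun β => green (extendIcc (stepFixedPoint hε hlam hη β).1.2) (3 / 4) :=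
      (continuous_green_extendIcc _ h34).comp (by fun_prop)
    fun_prop
  have hmaps : ∀ β, F β ∈ Icc (0:ℝ) (1 / 10 ^ 8) := fun β => by
    have h := admissible_extendIcc (stepFixedPoint hε hlam hη β)
    have h0 := hε.1
    have h0' := hε.2
    have hθ0 := hθ.1
    have hθ' := hθ.2
    have h1 := h.abs_left_le _ h14
    have h2 := abs_green_le h.abs_right_le h34
    refine ⟨by positivity, ?_⟩
    simp only [F]
    rw [← sq_abs, ← Even.pow_abs (by decide : Even 4) (green _ _)]
    calc _ ≤ (1 / 2 : ℝ) * (1 / 10 * (1 / 10000) ^ 2 + (1 / 10) ^ 3 * (2 * (1 / 50)) ^ 4) := by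
          gcongr
      _ ≤ 1 / 10 ^ 8 := by norm_num
  obtain ⟨β, hβ, hfix⟩ := exists_mem_Icc_isFixedPt_of_mapsTo (a := 0) (b := 1 / 10 ^ 8)
    (f := IccExtend (by norm_num) F) (hF.Icc_extend').continuousOn (by norm_num)
    (fun _ _ => hmaps _)
  rw [Function.IsFixedPt, IccExtend_of_mem _ _ hβ] at hfix
  have hx := (contracting_stepMap hε hlam hη ⟨β, hβ⟩).fixedPoint_isFixedPt
  change stepMap hε hlam hη ⟨β, hβ⟩ (stepFixedPoint hε hlam hη ⟨β, hβ⟩) = _ at hx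
  have h := admissible_extendIcc (stepFixedPoint hε hlam hη ⟨β, hβ⟩)
  refine ⟨_, _, β, hβ, h, fun t ht => ?_, fun t ht => ?_, hfix.symm⟩
  · conv_lhs => rw [← show _ = stepFixedPoint hε hlam hη ⟨β, hβ⟩ from hx]
    exact extendIcc_restrictIcc (h.profile_slope hε hβ hlam hη).cont_left ht
  · conv_lhs => rw [← show _ = stepFixedPoint hε hlam hη ⟨β, hβ⟩ from hx]
    exact extendIcc_restrictIcc (h.profile_slope hε hβ hlam hη).cont_right ht

end FixedPoint

lemma D_eqOn_of_hasDerivWithinAt {F : ℕ → ℝ → ℝ} {n : ℕ}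
    (h : ∀ i < n, ∀ t ∈ Icc (0:ℝ) 1, HasDerivWithinAt (F i) (F (i + 1) t) (Icc 0 1) t) :
    ∀ i ≤ n, EqOn (D i (F 0)) (F i) (Icc 0 1) := by
  intro i
  induction i with
  | zero => intro _ t _; simp [D]
  | succ i ih =>
    intro hi t ht
    have hd := (h i hi t ht).congr (fun s hs => ih (by lia) hs) (ih (by lia) ht)
    rw [D, iteratedDerivWithin_succ]
    exact hd.derivWithin (uniqueDiffOn_Icc zero_lt_one t ht)

lemma contDiffOn_of_hasDerivWithinAt {F : ℕ → ℝ → ℝ} {n : ℕ}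
    (h : ∀ i < n, ∀ t ∈ Icc (0:ℝ) 1, HasDerivWithinAt (F i) (F (i + 1) t) (Icc 0 1) t)
    (hn : ContinuousOn (F n) (Icc 0 1)) : ContDiffOn ℝ n (F 0) (Icc 0 1) := by
  have hD := D_eqOn_of_hasDerivWithinAt h
  refine contDiffOn_of_continuousOn_differentiableOn_deriv (fun m hm => ?_) (fun m hm => ?_)
  · have hm' : m ≤ n := by exact_mod_cast hm
    refine ContinuousOn.congr ?_ (hD m hm')
    rcases hm'.eq_or_lt with rfl | hlt
    · exact hn
    · exact fun t ht => (h m hlt t ht).continuousWithinAt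
  · have hm' : m < n := by exact_mod_cast hm
    exact DifferentiableOn.congr (fun t ht => (h m hm' t ht).differentiableWithinAt)
      (hD m hm'.le)

lemma sup01_le {g : ℝ → ℝ} {M : ℝ} (h : ∀ t ∈ Icc (0:ℝ) 1, |g t| ≤ M) : sup01 g ≤ M :=
  ciSup_le fun t : Icc (0:ℝ) 1 => h t t.2

lemma le_sup01 {g : ℝ → ℝ} {M : ℝ} (h : ∀ t ∈ Icc (0:ℝ) 1, |g t| ≤ M) {t : ℝ}
    (ht : t ∈ Icc (0:ℝ) 1) : |g t| ≤ sup01 g :=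
  le_ciSup (f := fun s : Icc (0:ℝ) 1 => |g s|)
    ⟨M, by rintro _ ⟨s, rfl⟩; exact h s s.2⟩ (⟨t, ht⟩ : Icc (0:ℝ) 1)

lemma hasDerivAt_slopeMap {z p : ℝ → ℝ} (hz : Continuous z) (hp : Continuous p)
    (ε lam η t : ℝ) :
    HasDerivAt (slopeMap ε lam η z p) (-(ε * lam * source ε z p t)) t := by
  have h := (((hasDerivAt_greenDeriv (continuous_source hz hp ε) t).const_mul lam).const_add
    (η * ∫ s in (0:ℝ)..1, (z s - greenDeriv p s) ^ 2)).const_mul ε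
  exact h.congr_deriv (by ring)

lemma prim_slopeMap {z p : ℝ → ℝ} (hz : Continuous z) (hp : Continuous p) (ε lam η t : ℝ) :
    prim (slopeMap ε lam η z p) t =
      ε * (η * (∫ s in (0:ℝ)..1, (z s - greenDeriv p s) ^ 2) * t +
        lam * green (source ε z p) t) := by
  have hc := (continuous_greenDeriv (continuous_source hz hp ε)).intervalIntegrable
    (μ := volume) 0 t
  simp only [prim, slopeMap]
  rw [intervalIntegral.integral_const_mul, intervalIntegral.integral_add (by simp)
    (hc.const_mul lam), intervalIntegral.integral_const_mul lam]
  simp only [intervalIntegral.integral_const, smul_eq_mul, green, prim]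
  ring

lemma prim_congr {q r : ℝ → ℝ} (h : ∀ t ∈ Icc (0:ℝ) 1, q t = r t) {t : ℝ}
    (ht : t ∈ Icc (0:ℝ) 1) : prim q t = prim r t := by
  refine intervalIntegral.integral_congr fun s hs => ?_
  rw [uIcc_of_le ht.1] at hs
  exact h s ⟨hs.1, hs.2.trans ht.2⟩

/-- if `λ₂ > 0` and
`max{ (3/2)λ₁ + 4η₁₁, (5e²/24)λ₂ + 2η₂₁, (e²/2)λ₂ } ≤ 1`, then the boundary
value problem
`u₁'' + λ₁ f₁(t,u₁,u₁',u₂,u₂',u₂'',u₂''') = 0`,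
`u₂'''' = λ₂ f₂(t,u₁,u₁',u₂,u₂',u₂'',u₂''')` on `(0,1)`,
`u₁(0) = 0`, `u₁(1) = η₁₁ h₁₁[(u₁,u₂)]`, `u₂(0) = η₂₁ h₂₁[(u₁,u₂)]`,
`u₂''(0) = u₂(1) = u₂''(1) = 0`,
with the explicit data above, has a nonnegative solution `(u₁,u₂)` with
`0 < ‖(u₁,u₂)‖ ≤ 1`. -/
theorem stmt_17 (lam₁ lam₂ η₁₁ η₂₁ : ℝ)
    (hlam₁ : 0 ≤ lam₁) (hlam₂ : 0 < lam₂) (hη₁₁ : 0 ≤ η₁₁) (hη₂₁ : 0 ≤ η₂₁)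
    (hmax : max (max ((3 / 2) * lam₁ + 4 * η₁₁) ((5 * Real.exp 2 / 24) * lam₂ + 2 * η₂₁))
      ((Real.exp 2 / 2) * lam₂) ≤ 1) :
    ∃ u₁ u₂ : ℝ → ℝ,
      ContDiffOn ℝ 2 u₁ (Set.Icc 0 1) ∧ ContDiffOn ℝ 4 u₂ (Set.Icc 0 1) ∧
      (∀ t ∈ Set.Icc (0:ℝ) 1, 0 ≤ u₁ t ∧ 0 ≤ u₂ t) ∧
      (∀ t ∈ Set.Ioo (0:ℝ) 1,
        D 2 u₁ t + lam₁ * f₁ex t (u₁ t) (D 1 u₁ t) (u₂ t) (D 1 u₂ t) (D 2 u₂ t) (D 3 u₂ t) = 0) ∧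
      (∀ t ∈ Set.Ioo (0:ℝ) 1,
        D 4 u₂ t = lam₂ * f₂ex t (u₁ t) (D 1 u₁ t) (u₂ t) (D 1 u₂ t) (D 2 u₂ t) (D 3 u₂ t)) ∧
      u₁ 0 = 0 ∧ u₁ 1 = η₁₁ * h₁₁ex u₁ u₂ ∧ u₂ 0 = η₂₁ * h₂₁ex u₁ u₂ ∧
      D 2 u₂ 0 = 0 ∧ u₂ 1 = 0 ∧ D 2 u₂ 1 = 0 ∧
      0 < normPair u₁ u₂ ∧ normPair u₁ u₂ ≤ 1 := by
  have hexp : (2.7:ℝ) ^ 2 ≤ exp 2 := by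
    have h := Real.exp_one_gt_d9
    rw [show (2:ℝ) = 1 + 1 by norm_num, Real.exp_add]
    nlinarith
  have hexp0 := Real.exp_pos 2
  obtain ⟨⟨hm1, hm2⟩, hm3⟩ := by simpa only [max_le_iff] using hmax
  have hlam₂' : lam₂ ≤ 3 / 10 := by nlinarith
  have hε0 : 0 < lam₂ ^ 2 := by positivity
  have hε : lam₂ ^ 2 ∈ Icc (0:ℝ) (1 / 10) := ⟨hε0.le, by nlinarith⟩
  have hlam : lam₁ ∈ Icc (0:ℝ) (2 / 3) := ⟨hlam₁, by linarith⟩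
  have hη : η₁₁ ∈ Icc (0:ℝ) (1 / 4) := ⟨hη₁₁, by linarith⟩
  have hθ : η₂₁ ∈ Icc (0:ℝ) (1 / 2) := ⟨hη₂₁, by
    have : 0 ≤ 5 * exp 2 / 24 * lam₂ := by positivity
    linarith⟩
  obtain ⟨z, p, β, hβ, hadm, hz, hp, hβeq⟩ := exists_rescaled_solution hε hlam hη hθ
  set ε := lam₂ ^ 2 with hεdef
  have hzc := hadm.cont_left
  have hpc := hadm.cont_right
  have hprim : ∀ t ∈ Icc (0:ℝ) 1, prim z t = _ := fun t ht =>
    (prim_congr hz ht).trans (prim_slopeMap hzc hpc ε lam₁ η₁₁ t)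
  let F : ℕ → ℝ → ℝ
    | 0 => fun t => ε * prim z t
    | 1 => fun t => ε * z t
    | _ => fun t => ε * -(ε * lam₁ * source ε z p t)
  let H : ℕ → ℝ → ℝ
    | 0 => fun t => ε * (β * (1 - t) + green (green p) t)
    | 1 => fun t => ε * (-β + greenDeriv (green p) t)
    | 2 => fun t => ε * -green p t
    | 3 => fun t => ε * -greenDeriv p t
    | _ => fun t => ε * p t
  have hF : ∀ i < 2, ∀ t ∈ Icc (0:ℝ) 1, HasDerivWithinAt (F i) (F (i + 1) t) (Icc 0 1) t := by
    intro i hi t ht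
    interval_cases i
    · exact ((hasDerivAt_prim hzc t).const_mul ε).hasDerivWithinAt
    · exact ((hasDerivAt_slopeMap hzc hpc ε lam₁ η₁₁ t).hasDerivWithinAt.congr hz
        (hz t ht)).const_mul ε
  have hH : ∀ i < 4, ∀ t ∈ Icc (0:ℝ) 1, HasDerivWithinAt (H i) (H (i + 1) t) (Icc 0 1) t := by
    intro i hi t ht
    interval_cases i
    · have h := ((((hasDerivAt_id t).const_sub 1).const_mul β).add
        (hasDerivAt_green (continuous_green hpc) t)).const_mul ε
      refine (h.congr_deriv ?_).hasDerivWithinAt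
      change _ = ε * (-β + greenDeriv (green p) t)
      ring
    · exact (((hasDerivAt_greenDeriv (continuous_green hpc) t).const_add
        (-β)).const_mul ε).hasDerivWithinAt
    · exact ((hasDerivAt_green hpc t).neg.const_mul ε).hasDerivWithinAt
    · have h := (hasDerivAt_greenDeriv hpc t).neg.const_mul ε
      refine (h.congr_deriv ?_).hasDerivWithinAt
      change _ = ε * p t
      ring
  have hDF := D_eqOn_of_hasDerivWithinAt hF
  have hDH := D_eqOn_of_hasDerivWithinAt hH
  have hF1 : ∀ t ∈ Icc (0:ℝ) 1, D 1 (F 0) t = ε * z t := hDF 1 (by norm_num)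
  have hF2 : ∀ t ∈ Icc (0:ℝ) 1, D 2 (F 0) t = ε * -(ε * lam₁ * source ε z p t) :=
    hDF 2 (by norm_num)
  have hH1 : ∀ t ∈ Icc (0:ℝ) 1, D 1 (H 0) t = ε * (-β + greenDeriv (green p) t) :=
    hDH 1 (by norm_num)
  have hH2 : ∀ t ∈ Icc (0:ℝ) 1, D 2 (H 0) t = ε * -green p t := hDH 2 (by norm_num)
  have hH3 : ∀ t ∈ Icc (0:ℝ) 1, D 3 (H 0) t = ε * -greenDeriv p t := hDH 3 (by norm_num)
  have hH4 : ∀ t ∈ Icc (0:ℝ) 1, D 4 (H 0) t = ε * p t := hDH 4 (by norm_num)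
  have h0 : (0:ℝ) ∈ Icc (0:ℝ) 1 := by norm_num
  have h1 : (1:ℝ) ∈ Icc (0:ℝ) 1 := by norm_num
  have hrad : ∀ t ∈ Icc (0:ℝ) 1, 0 ≤ β * (1 - t) + green (green p) t := fun t ht =>
    (mul_nonneg (by norm_num) (parabola_nonneg ht)).trans (hadm.radicand_ge hβ ht)
  have hscale : ∀ {x : ℝ}, |x| ≤ 1 → |ε * x| ≤ 1 := fun {x} hx => by
    rw [abs_mul, abs_of_pos hε0]
    nlinarith [hε.2, abs_nonneg x]
  have hbound : ∀ t ∈ Icc (0:ℝ) 1, |H 0 t| ≤ 1 := fun t ht => by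
    refine hscale ?_
    rw [abs_of_nonneg (hrad t ht)]
    exact (hadm.radicand_le hβ ht).trans (by norm_num)
  refine ⟨F 0, H 0, contDiffOn_of_hasDerivWithinAt hF ?_, contDiffOn_of_hasDerivWithinAt hH ?_,
    fun t ht => ⟨?_, mul_nonneg hε0.le (hrad t ht)⟩, fun t ht => ?_, fun t ht => ?_, ?_, ?_, ?_,
    ?_, ?_, ?_, ?_, ?_⟩
  · have := continuous_source hzc hpc ε
    exact Continuous.continuousOn (by fun_prop)
  · exact Continuous.continuousOn (by fun_prop)
  · have hA : 0 ≤ ∫ s in (0:ℝ)..1, (z s - greenDeriv p s) ^ 2 :=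
      intervalIntegral.integral_nonneg zero_le_one fun _ _ => sq_nonneg _
    have hg := green_nonneg (continuous_source hzc hpc ε)
      (fun s hs => Admissible.source_nonneg hs) ht
    have ht0 := ht.1
    change 0 ≤ ε * prim z t
    rw [hprim t ht]
    positivity
  · have ht' := Ioo_subset_Icc_self ht
    rw [hF1 t ht', hF2 t ht', hH2 t ht']
    change _ + lam₁ * ((ε * prim z t) ^ 2 * (2 - t * sin (ε * z t + ε * -green p t))) = 0
    rw [source, show ε * z t + ε * -green p t = ε * (z t - green p t) by ring]
    ring
  · have ht' := Ioo_subset_Icc_self ht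
    rw [hH4 t ht', hH3 t ht', hp t ht']
    change _ = lam₂ * (√(ε * (β * (1 - t) + green (green p) t)) *
      exp (t * (ε * prim z t + ε * -greenDeriv p t)))
    rw [profileMap, Real.sqrt_mul hε0.le, hεdef, Real.sqrt_sq hlam₂.le, ← hεdef,
      show ε * prim z t + ε * -greenDeriv p t = ε * (prim z t - greenDeriv p t) by ring]
    ring
  · simp [F, prim_zero]
  · have hint : h₁₁ex (F 0) (H 0) = ε ^ 2 * ∫ s in (0:ℝ)..1, (z s - greenDeriv p s) ^ 2 := by
      rw [h₁₁ex, ← intervalIntegral.integral_const_mul]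
      refine intervalIntegral.integral_congr fun s hs => ?_
      rw [uIcc_of_le zero_le_one] at hs
      simp only [hF1 s hs, hH3 s hs]
      ring
    change ε * prim z 1 = _
    rw [hint, hprim 1 h1, green_one (continuous_source hzc hpc ε)]
    ring
  · rw [h₂₁ex, hF1 _ (by norm_num), hH2 _ (by norm_num)]
    change ε * (β * (1 - 0) + green (green p) 0) = _
    rw [green_zero, hβeq]
    ring
  · rw [hH2 0 h0, green_zero]; simp
  · change ε * (β * (1 - 1) + green (green p) 1) = 0
    rw [green_one (continuous_green hpc)]; simp
  · rw [hH2 1 h1, green_one hpc]; simp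
  · have h12 : (1 / 2 : ℝ) ∈ Icc (0:ℝ) 1 := by norm_num
    have hpos : 0 < H 0 (1 / 2) := by
      have := hadm.radicand_ge hβ h12
      exact mul_pos hε0 (lt_of_lt_of_le (by norm_num) this)
    refine lt_of_lt_of_le (hpos.trans_le ((le_abs_self _).trans (le_sup01 hbound h12))) ?_
    exact (le_max_left _ _).trans ((le_max_left _ _).trans (le_max_right _ _))
  · refine max_le (max_le (sup01_le fun t ht => ?_) (sup01_le fun t ht => ?_))
      (max_le (max_le (sup01_le hbound) (sup01_le fun t ht => ?_))
        (max_le (sup01_le fun t ht => ?_) (sup01_le fun t ht => ?_)))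
    · exact hscale ((abs_prim_le hadm.abs_left_le ht).trans (by norm_num))
    · rw [hF1 t ht]
      exact hscale ((hadm.abs_left_le t ht).trans (by norm_num))
    · rw [hH1 t ht]
      refine hscale ((abs_add_le _ _).trans ?_)
      have := abs_greenDeriv_le (fun s hs => abs_green_le hadm.abs_right_le hs) ht
      rw [abs_neg, abs_of_nonneg hβ.1]
      have := hβ.2
      norm_num at *
      linarith
    · rw [hH2 t ht]
      refine hscale ?_
      rw [abs_neg]
      exact (abs_green_le hadm.abs_right_le ht).trans (by norm_num)
    · rw [hH3 t ht]
      refine hscale ?_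
      rw [abs_neg]
      exact (abs_greenDeriv_le hadm.abs_right_le ht).trans (by norm_num)
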